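/- arXiv:2301.00615 — 2 statements merged into one kernel-verified Lean document; each statement's English description precedes it below -/
import Mathlib

section
/- The TowerSketch online query never underestimates a flow's size: let F be a finite set of flows with true sizes n : F → ℕ, and for each array i ∈ {1,…,l} let s_i : F → Fin w_i be its hash function and cap_i = 2^{δ_i} − 1 its counter capacity. Suppose each counter holds A_i[j] = min(cap_i, ∑_{g ∈ F, s_i g = j} n g). Define the query for f ∈ F as the minimum over i of the value v_i ∈ ℕ∞, where v_i = ⊤ if A_i[s_i f] = cap_i (a saturated counter is regarded as +∞) and v_i = A_i[s_i f] otherwise. Then (n f : ℕ∞) ≤ query f. -/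
open Finset in
/-- The TowerSketch online query never underestimates a flow's size: each mapped
counter holds the saturated sum of the sizes of the flows hashed to it, saturated
counters are regarded as `⊤`, and the reported minimum over the `l` arrays is at
least the true flow size. -/
theorem towersketch_no_underestimate
    {F : Type*} [Fintype F] (n : F → ℕ)
    (l : ℕ) (w δ : Fin l → ℕ)
    (s : (i : Fin l) → F → Fin (w i))
    (A : (i : Fin l) → Fin (w i) → ℕ)
    (hA : ∀ (i : Fin l) (j : Fin (w i)),
      A i j = min (2 ^ (δ i) - 1) (∑ g ∈ univ.filter (fun g => s i g = j), n g))
    (f : F) :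
    (n f : ℕ∞) ≤
      ⨅ i : Fin l,
        (if A i (s i f) = 2 ^ (δ i) - 1 then (⊤ : ℕ∞) else (A i (s i f) : ℕ∞)) := by
  refine le_iInf fun i => ?_
  split_ifs with h
  · exact le_top
  · have hle : n f ≤ ∑ g ∈ univ.filter (fun g => s i g = s i f), n g :=
      single_le_sum (f := n) (fun _ _ => Nat.zero_le _) (by simp)
    have hAf := hA i (s i f)
    exact Nat.cast_le.mpr (by omega)
end

section
/- Numerical values of the decoding-threshold constants of Theorem 1: for an integer d ≥ 3, let A_d = { α ∈ (0,1) | ∀ x ∈ (0,1), 1 − exp(−d·α·x^{d−1}) < x } and define c_d = (sSup A_d)⁻¹. Then |c_3 − 1.23| < 0.01, |c_4 − 1.30| < 0.01, and |c_5 − 1.43| < 0.01. -/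
/-- The set `A_d` of feasible load factors `α` from Theorem 1. -/
def decodingSet (d : ℕ) : Set ℝ :=
  {α | α ∈ Set.Ioo (0 : ℝ) 1 ∧
    ∀ x ∈ Set.Ioo (0 : ℝ) 1, 1 - Real.exp (-(d : ℝ) * α * x ^ (d - 1)) < x}

/-- The decoding-threshold constant `c_d = (sSup A_d)⁻¹`. -/
noncomputable def decodingConst (d : ℕ) : ℝ := (sSup (decodingSet d))⁻¹

/-- The cubic Taylor polynomial of `-log (1 - s)` is a lower bound for it on `s < 1`. -/
lemma cubic_le_neg_log_one_sub {s : ℝ} (hs : s < 1) :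
    s + s ^ 2 / 2 + s ^ 3 / 3 ≤ -Real.log (1 - s) := by
  let f : ℝ → ℝ := fun t => -Real.log (1 - t) - (t + t ^ 2 / 2 + t ^ 3 / 3)
  have hd : ∀ t < 1, HasDerivAt f (t ^ 3 / (1 - t)) t := by
    intro t ht
    have h1 : 1 - t ≠ 0 := by linarith
    have hlog := (((hasDerivAt_id t).const_sub 1).log h1).neg
    have hpoly := ((hasDerivAt_id t).add ((hasDerivAt_pow 2 t).div_const 2)).add
      ((hasDerivAt_pow 3 t).div_const 3)
    refine (hlog.sub hpoly).congr_deriv ?_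
    simp only [id]
    field_simp
    push_cast
    ring
  have hc : ContinuousOn f (Set.Iio 1) := fun t ht => (hd t ht).continuousAt.continuousWithinAt
  have h0 : f 0 = 0 := by simp [f]
  suffices h : f 0 ≤ f s by
    rw [h0] at h
    simp only [f] at h
    linarith
  rcases le_total 0 s with h | h
  · refine monotoneOn_of_deriv_nonneg (convex_Icc 0 s)
      (hc.mono fun t ht => lt_of_le_of_lt ht.2 hs) ?_ ?_ ⟨le_rfl, h⟩ ⟨h, le_rfl⟩ h
    all_goals
      rw [interior_Icc]
      intro t ht
      have ht1 : t < 1 := ht.2.trans hs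
    · exact (hd t ht1).differentiableAt.differentiableWithinAt
    · rw [(hd t ht1).deriv]
      exact div_nonneg (pow_nonneg ht.1.le 3) (by linarith)
  · refine antitoneOn_of_deriv_nonpos (convex_Icc s 0)
      (hc.mono fun t ht => lt_of_le_of_lt ht.2 one_pos) ?_ ?_ ⟨le_rfl, h⟩ ⟨h, le_rfl⟩ h
    all_goals
      rw [interior_Icc]
      intro t ht
      have ht1 : t < 1 := ht.2.trans one_pos
    · exact (hd t ht1).differentiableAt.differentiableWithinAt
    · rw [(hd t ht1).deriv]
      exact div_nonpos_of_nonpos_of_nonneg (Odd.pow_nonpos (by decide) ht.2.le) (by linarith)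

/-- Cubic lower bound for `-log (1 - x)` obtained by expanding at `x = 1 - 2⁻ᵏ`. -/
lemma dyadic_cubic_le_neg_log_one_sub (k : ℕ) {x s : ℝ} (hx : x < 1)
    (hs : s = 1 - 2 ^ k * (1 - x)) :
    k * 0.6931471803 + (s + s ^ 2 / 2 + s ^ 3 / 3) ≤ -Real.log (1 - x) := by
  have hx' : 0 < 1 - x := by linarith
  have hk : (0 : ℝ) < 2 ^ k := by positivity
  have h := cubic_le_neg_log_one_sub (s := s) (by rw [hs]; linarith [mul_pos hk hx'])
  rw [show 1 - s = 2 ^ k * (1 - x) by rw [hs]; ring, Real.log_mul hk.ne' hx'.ne',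
    Real.log_pow] at h
  have := mul_le_mul_of_nonneg_left Real.log_two_gt_d9.le (Nat.cast_nonneg (α := ℝ) k)
  linarith

lemma mem_decodingSet_of_lt_neg_log {d : ℕ} {α : ℝ} (hα : α ∈ Set.Ioo (0 : ℝ) 1)
    (h : ∀ x ∈ Set.Ioo (0 : ℝ) 1, d * α * x ^ (d - 1) < -Real.log (1 - x)) :
    α ∈ decodingSet d := by
  refine ⟨hα, fun x hx => ?_⟩
  have h1 : 0 < 1 - x := by linarith [hx.2]
  have h2 := (Real.log_lt_iff_lt_exp h1).1 (show Real.log (1 - x) < -(d : ℝ) * α * x ^ (d - 1) by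
    linarith [h x hx])
  linarith

lemma le_of_mem_decodingSet {d : ℕ} {α u x : ℝ} (n : ℕ) (hα : α ∈ decodingSet d)
    (hu : 0 ≤ u) (hx : x ∈ Set.Ioo (0 : ℝ) 1)
    (h : 1 ≤ (1 - x) * ∑ i ∈ Finset.range n, (d * u * x ^ (d - 1)) ^ i / i.factorial) :
    α ≤ u := by
  by_contra! hlt
  have hx0 : 0 < x := hx.1
  have h1 : 0 < 1 - x := by linarith [hx.2]
  set t := d * u * x ^ (d - 1)
  have ht : 0 ≤ t := by positivity
  have h2 : 1 ≤ (1 - x) * Real.exp t :=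
    h.trans (mul_le_mul_of_nonneg_left (Real.sum_le_exp_of_nonneg ht n) h1.le)
  have h3 : t ≤ d * α * x ^ (d - 1) := by
    simp only [t]
    gcongr
  have h4 : 1 - x < Real.exp (-t) := by
    refine lt_of_lt_of_le (by linarith [hα.2 x hx])
      (Real.exp_le_exp.2 (show -(d : ℝ) * α * x ^ (d - 1) ≤ -t by linarith))
  have h5 := mul_lt_mul_of_pos_right h4 (Real.exp_pos t)
  rw [← Real.exp_add, neg_add_cancel, Real.exp_zero] at h5
  linarith

lemma decodingConst_mem_Icc {d : ℕ} {l u : ℝ} (hl : l ∈ decodingSet d)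
    (hu : ∀ α ∈ decodingSet d, α ≤ u) : decodingConst d ∈ Set.Icc u⁻¹ l⁻¹ := by
  have h1 : l ≤ sSup (decodingSet d) := le_csSup ⟨u, hu⟩ hl
  have h2 : sSup (decodingSet d) ≤ u := csSup_le ⟨l, hl⟩ hu
  have hl0 : 0 < l := hl.1.1
  exact ⟨inv_anti₀ (hl0.trans_le h1) h2, inv_anti₀ hl0 h1⟩

lemma mem_decodingSet_three : (0.807 : ℝ) ∈ decodingSet 3 := by
  refine mem_decodingSet_of_lt_neg_log (by norm_num) fun x ⟨hx0, hx1⟩ => ?_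
  norm_num only
  rcases le_total x 0.56 with h | h
  · refine lt_of_lt_of_le ?_ (dyadic_cubic_le_neg_log_one_sub 0 hx1 rfl)
    norm_num only
    nlinarith [mul_pos hx0 hx0, mul_nonneg hx0.le (mul_nonneg hx0.le (sub_nonneg.2 h)),
      mul_nonneg hx0.le (sub_nonneg.2 h)]
  · refine lt_of_lt_of_le ?_ (dyadic_cubic_le_neg_log_one_sub 2 hx1 rfl)
    norm_num only
    nlinarith [mul_nonneg (sub_nonneg.2 h) (sq_nonneg (x - 0.71)), sq_nonneg (x - 0.71)]

lemma mem_decodingSet_four : (0.7635 : ℝ) ∈ decodingSet 4 := by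
  refine mem_decodingSet_of_lt_neg_log (by norm_num) fun x ⟨hx0, hx1⟩ => ?_
  norm_num only
  rcases le_total x 0.6 with h | h
  · refine lt_of_lt_of_le ?_ (dyadic_cubic_le_neg_log_one_sub 0 hx1 rfl)
    norm_num only
    nlinarith [mul_pos hx0 hx0, mul_nonneg hx0.le (mul_nonneg hx0.le (sub_nonneg.2 h)),
      mul_nonneg hx0.le (sub_nonneg.2 h)]
  · refine lt_of_lt_of_le ?_ (dyadic_cubic_le_neg_log_one_sub 2 hx1 rfl)
    norm_num only
    nlinarith [mul_nonneg (sub_nonneg.2 h) (sq_nonneg (x - 0.84)), sq_nonneg (x - 0.84)]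

lemma mem_decodingSet_five : (0.6945 : ℝ) ∈ decodingSet 5 := by
  refine mem_decodingSet_of_lt_neg_log (by norm_num) fun x ⟨hx0, hx1⟩ => ?_
  norm_num only
  rcases le_total x 0.74 with h | h
  · refine lt_of_lt_of_le ?_ (dyadic_cubic_le_neg_log_one_sub 0 hx1 rfl)
    norm_num only
    have h3 : x ^ 3 ≤ 0.74 ^ 3 := by gcongr
    nlinarith [mul_nonneg hx0.le (sub_nonneg.2 h3), mul_pos hx0 hx0, pow_pos hx0 3]
  · refine lt_of_lt_of_le ?_ (dyadic_cubic_le_neg_log_one_sub 3 hx1 rfl)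
    norm_num only
    nlinarith [mul_nonneg (sub_nonneg.2 h) (sq_nonneg (x - 0.9)), sq_nonneg (x - 0.9),
      mul_nonneg (mul_nonneg (sub_nonneg.2 h) (sub_nonneg.2 hx1.le)) (sq_nonneg (x - 0.9))]

/-- Numerical values of the decoding-threshold constants of Theorem 1:
`c_3 ≈ 1.23`, `c_4 ≈ 1.30`, `c_5 ≈ 1.43` up to `0.01`. -/
theorem decodingConst_values :
    |decodingConst 3 - 1.23| < 0.01 ∧
    |decodingConst 4 - 1.30| < 0.01 ∧
    |decodingConst 5 - 1.43| < 0.01 := by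
  have h3 := decodingConst_mem_Icc mem_decodingSet_three fun α hα =>
    le_of_mem_decodingSet (u := 0.8196) (x := 5 / 7) 10 hα (by norm_num) (by norm_num)
      (by norm_num [Finset.sum_range_succ, Nat.factorial])
  have h4 := decodingConst_mem_Icc mem_decodingSet_four fun α hα =>
    le_of_mem_decodingSet (u := 0.775) (x := 0.85) 12 hα (by norm_num) (by norm_num)
      (by norm_num [Finset.sum_range_succ, Nat.factorial])
  have h5 := decodingConst_mem_Icc mem_decodingSet_five fun α hα =>
    le_of_mem_decodingSet (u := 0.704) (x := 0.9) 12 hα (by norm_num) (by norm_num)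
      (by norm_num [Finset.sum_range_succ, Nat.factorial])
  norm_num at h3 h4 h5
  refine ⟨abs_lt.2 ⟨?_, ?_⟩, abs_lt.2 ⟨?_, ?_⟩, abs_lt.2 ⟨?_, ?_⟩⟩ <;> norm_num <;> linarith
end
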